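/- arXiv:2309.15620 — 9 statements merged into one kernel-verified Lean document; each statement's English description precedes it below -/
import Mathlib

section
/- Let M be a cancellative commutative monoid with Grothendieck group G, let R = ⊕_{m∈M} R_m be an M-graded commutative ring, and let S be a multiplicative subset of R consisting of homogeneous elements. For each x ∈ G let (S⁻¹R)_x be the set of all f ∈ S⁻¹R such that f = 0 or f admits a presentation f = r/s with r ∈ R and s ∈ S homogeneous and x = [deg(r), deg(s)] in G. Then each (S⁻¹R)_x is an additive subgroup of S⁻¹R, (S⁻¹R)_x · (S⁻¹R)_y ⊆ (S⁻¹R)_{x+y} for all x, y ∈ G, and S⁻¹R = ⊕_{x∈G} (S⁻¹R)_x; that is, S⁻¹R is a G-graded ring with homogeneous components (S⁻¹R)_x. -/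
namespace GradedLoc

variable {M : Type*} [AddCommMonoid M] [DecidableEq M]
  {R : Type*} [CommRing R] (ℳ : M → AddSubgroup R) [GradedRing ℳ] (S : Submonoid R)

/-- The class `[m, n]` in the Grothendieck group. -/
abbrev cls (m n : M) : AddLocalization (⊤ : AddSubmonoid M) :=
  AddLocalization.mk m ⟨n, AddSubmonoid.mem_top n⟩

lemma cls_add (m n m' n' : M) : cls m n + cls m' n' = cls (m + m') (n + n') :=
  AddLocalization.mk_add _ _ _ _

lemma cls_self (m : M) : cls m m = 0 :=
  AddLocalization.mk_self (⟨m, AddSubmonoid.mem_top m⟩ : (⊤ : AddSubmonoid M))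

/-- The map `r ↦ ∑ (r_m / 1) T ^ [m, 0]` into the group algebra. -/
noncomputable def phi :
    R →+* AddMonoidAlgebra (Localization S) (AddLocalization (⊤ : AddSubmonoid M)) :=
  (DirectSum.toSemiring (A := fun i => ℳ i)
    (fun i => (AddMonoidAlgebra.singleAddHom (cls i 0)).comp
      ((algebraMap R (Localization S)).toAddMonoidHom.comp (ℳ i).subtype))
    (by
      change AddMonoidAlgebra.single (cls 0 0) (algebraMap R (Localization S) 1) = 1
      rw [cls_self, map_one]; rfl)
    (by
      intro i j a b
      change AddMonoidAlgebra.single (cls (i + j) 0)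
          (algebraMap R (Localization S) ((a : R) * (b : R)))
        = AddMonoidAlgebra.single (cls i 0) (algebraMap R (Localization S) a) *
          AddMonoidAlgebra.single (cls j 0) (algebraMap R (Localization S) b)
      rw [AddMonoidAlgebra.single_mul_single, cls_add, map_mul, add_zero])).comp
  (DirectSum.decomposeRingEquiv ℳ).toRingHom

lemma phi_of_mem {r : R} {m : M} (h : r ∈ ℳ m) :
    phi ℳ S r = AddMonoidAlgebra.single (cls m 0) (algebraMap R (Localization S) r) := by
  have h0 : DirectSum.decomposeRingEquiv ℳ r = DirectSum.of (fun i => ℳ i) m ⟨r, h⟩ :=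
    DirectSum.decompose_of_mem ℳ h
  rw [phi, RingHom.comp_apply, RingEquiv.toRingHom_eq_coe, RingEquiv.coe_toRingHom, h0,
    DirectSum.toSemiring_of]
  rfl

lemma exists_psi (hS : ∀ s ∈ S, ∃ m, s ∈ ℳ m) :
    ∃ ψ : Localization S →+*
        AddMonoidAlgebra (Localization S) (AddLocalization (⊤ : AddSubmonoid M)),
      ∀ (r : R) (s : S) (m n : M), r ∈ ℳ m → (s : R) ∈ ℳ n →
        ψ (Localization.mk r s) = AddMonoidAlgebra.single (cls m n) (Localization.mk r s) := by
  have key : ∀ (s : S) (n : M), (s : R) ∈ ℳ n →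
      phi ℳ S s * AddMonoidAlgebra.single (cls 0 n) (Localization.mk 1 s) = 1 := by
    intro s n hn
    rw [phi_of_mem ℳ S hn, AddMonoidAlgebra.single_mul_single, cls_add, add_zero, zero_add,
      cls_self, ← Localization.mk_one_eq_algebraMap, Localization.mk_mul, mul_one, one_mul,
      Localization.mk_self]
    rfl
  have hu : ∀ s : S, IsUnit (phi ℳ S s) := by
    intro s
    obtain ⟨n, hn⟩ := hS s s.2
    exact IsUnit.of_mul_eq_one _ (key s n hn)
  refine ⟨IsLocalization.lift (M := S) hu, ?_⟩
  intro r s m n hr hs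
  rw [Localization.mk_eq_mk', IsLocalization.lift_mk'_spec, phi_of_mem ℳ S hr,
    phi_of_mem ℳ S hs, AddMonoidAlgebra.single_mul_single, cls_add, zero_add, add_comm n m,
    IsLocalization.mk'_spec']
  congr 1
  rw [← add_zero (cls m 0), ← cls_self n, cls_add, zero_add]

/-- The homogeneous component of degree `x`. -/
def comp [IsCancelAdd M] (hS : ∀ s ∈ S, ∃ m, s ∈ ℳ m)
    (x : AddLocalization (⊤ : AddSubmonoid M)) : AddSubgroup (Localization S) where
  carrier := {f | f = 0 ∨ ∃ (r : R) (s : S) (m n : M), r ∈ ℳ m ∧ (s : R) ∈ ℳ n ∧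
    x = cls m n ∧ f = Localization.mk r s}
  zero_mem' := Or.inl rfl
  neg_mem' := by
    rintro f (rfl | ⟨r, s, m, n, hr, hs, hx, rfl⟩)
    · left; simp
    · exact Or.inr ⟨-r, s, m, n, neg_mem hr, hs, hx, by rw [Localization.neg_mk]⟩
  add_mem' := by
    rintro f g (rfl | ⟨r, s, m, n, hr, hs, hx, rfl⟩) (rfl | ⟨r', s', m', n', hr', hs', hx', rfl⟩)
    · left; simp
    · right; exact ⟨r', s', m', n', hr', hs', hx', by simp⟩
    · right; exact ⟨r, s, m, n, hr, hs, hx, by simp⟩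
    · right
      have h : n' + m = n + m' := by
        rw [hx] at hx'
        obtain ⟨c, hc⟩ := AddLocalization.r_iff_exists.1 (AddLocalization.mk_eq_mk_iff.1 hx')
        exact add_left_cancel hc
      refine ⟨s * r' + s' * r, s * s', n + m', n + n', ?_, SetLike.mul_mem_graded hs hs', ?_,
        Localization.add_mk _ _ _ _⟩
      · exact add_mem (SetLike.mul_mem_graded hs hr') (h ▸ SetLike.mul_mem_graded hs' hr)
      · rw [← cls_add, cls_self, zero_add, hx']

end GradedLoc

/-- Let `M` be a cancellative commutative monoid with Grothendieck group
`G = AddLocalization (⊤ : AddSubmonoid M)`, let `R = ⊕_{m ∈ M} R_m` be an `M`-graded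
commutative ring and `S` a multiplicative subset of `R` consisting of homogeneous
(in particular nonzero) elements.  For `x ∈ G`, the component `(S⁻¹R)_x` is the set of all
`f ∈ S⁻¹R` with `f = 0` or `f = r/s` with `r, s` homogeneous and `x = [deg r, deg s]`.
Then each component is an additive subgroup, components multiply into the component of the
sum of the degrees, and `S⁻¹R` is their direct sum, i.e. `S⁻¹R` is a `G`-graded ring. -/
theorem stmt_0 {M : Type*} [AddCommMonoid M] [IsCancelAdd M] [DecidableEq M]
    {R : Type*} [CommRing R] (ℳ : M → AddSubgroup R) [GradedRing ℳ]
    (S : Submonoid R) (hS : ∀ s ∈ S, s ≠ 0 ∧ ∃ m, s ∈ ℳ m)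
    [DecidableEq (AddLocalization (⊤ : AddSubmonoid M))] :
    ∃ 𝒜 : AddLocalization (⊤ : AddSubmonoid M) → AddSubgroup (Localization S),
      (∀ x, (𝒜 x : Set (Localization S)) =
        {f | f = 0 ∨ ∃ (r : R) (s : S) (m n : M), r ≠ 0 ∧ r ∈ ℳ m ∧ (s : R) ∈ ℳ n ∧
          x = AddLocalization.mk m ⟨n, AddSubmonoid.mem_top n⟩ ∧ f = Localization.mk r s}) ∧
      (∀ x y : AddLocalization (⊤ : AddSubmonoid M),
        ∀ a ∈ 𝒜 x, ∀ b ∈ 𝒜 y, a * b ∈ 𝒜 (x + y)) ∧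
      DirectSum.IsInternal 𝒜 := by
  have hS' : ∀ s ∈ S, ∃ m, s ∈ ℳ m := fun s hs => (hS s hs).2
  refine ⟨GradedLoc.comp ℳ S hS', ?_, ?_, ?_, ?_⟩
  · intro x
    ext f
    constructor
    · rintro (rfl | ⟨r, s, m, n, hr, hs, hx, rfl⟩)
      · exact Or.inl rfl
      · by_cases h : r = 0
        · left; rw [h, Localization.mk_zero]
        · exact Or.inr ⟨r, s, m, n, h, hr, hs, hx, rfl⟩
    · rintro (rfl | ⟨r, s, m, n, -, hr, hs, hx, rfl⟩)
      · exact Or.inl rfl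
      · exact Or.inr ⟨r, s, m, n, hr, hs, hx, rfl⟩
  · rintro x y a (rfl | ⟨r, s, m, n, hr, hs, rfl, rfl⟩) b hb
    · left; simp
    · rcases hb with (rfl | ⟨r', s', m', n', hr', hs', rfl, rfl⟩)
      · left; simp
      · exact Or.inr ⟨r * r', s * s', m + m', n + n', SetLike.mul_mem_graded hr hr',
          SetLike.mul_mem_graded hs hs', GradedLoc.cls_add _ _ _ _, Localization.mk_mul _ _ _ _⟩
  · obtain ⟨ψ, hψ⟩ := GradedLoc.exists_psi ℳ S hS'
    have h1 : ∀ x, ∀ f ∈ GradedLoc.comp ℳ S hS' x, ψ f = AddMonoidAlgebra.single x f := by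
      rintro x f (rfl | ⟨r, s, m, n, hr, hs, rfl, rfl⟩)
      · simp
      · exact hψ r s m n hr hs
    have h2 : ∀ v y, (ψ (DirectSum.coeAddMonoidHom (GradedLoc.comp ℳ S hS') v)).coeff y
        = (v y : Localization S) := by
      intro v y
      induction v using DirectSum.induction_on with
      | zero => simp
      | of i a =>
        rw [DirectSum.coeAddMonoidHom_of, h1 i a a.2, DirectSum.coe_of_apply]
        simp [Finsupp.single_apply]
        try (split_ifs <;> rfl)
      | add a b ha hb => simp [ha, hb]
    intro v w hvw
    ext y
    rw [← h2, ← h2, hvw]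
  · intro f
    induction f using Localization.induction_on with
    | H p =>
    obtain ⟨r, s⟩ := p
    obtain ⟨n, hn⟩ := hS' s s.2
    rw [← AddMonoidHom.mem_range]
    induction r using DirectSum.Decomposition.inductionOn ℳ with
    | zero => rw [Localization.mk_zero]; exact zero_mem _
    | @homogeneous i a =>
      exact ⟨DirectSum.of (fun x => GradedLoc.comp ℳ S hS' x) (GradedLoc.cls i n)
        ⟨Localization.mk a s, Or.inr ⟨a, s, i, n, a.2, hn, rfl, rfl⟩⟩,
        DirectSum.coeAddMonoidHom_of _ _ _⟩
    | add a b ha hb =>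
      have := add_mem ha hb
      rwa [Localization.add_mk_self] at this
end

section
/- Let R be a commutative ring, S a multiplicative subset of R, M a commutative monoid with Grothendieck group G, and let T = { s·ε_m : s ∈ S, m ∈ M }, a multiplicative subset of the monoid ring R[M]. Then there is a canonical ring isomorphism T⁻¹(R[M]) ≅ (S⁻¹R)[G] sending each fraction (r·ε_m)/(s·ε_n) to (r/s)·ε_{[m,n]}. -/
/-- Let `R` be a commutative ring, `S` a multiplicative subset of `R`, `M` a
commutative monoid with Grothendieck group `G = AddLocalization (⊤ : AddSubmonoid M)`, and let
`T = {s·ε_m : s ∈ S, m ∈ M}` be the corresponding multiplicative subset of the monoid ring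
`R[M]`.  Then there is a canonical ring isomorphism `T⁻¹(R[M]) ≃ (S⁻¹R)[G]` sending each
fraction `(r·ε_m)/(s·ε_n)` to `(r/s)·ε_{[m,n]}`. -/
theorem stmt_5 {R : Type*} [CommRing R] (S : Submonoid R)
    {M : Type*} [AddCommMonoid M]
    (T : Submonoid (AddMonoidAlgebra R M))
    (hT : (T : Set (AddMonoidAlgebra R M)) =
      {f | ∃ s ∈ S, ∃ m : M, f = AddMonoidAlgebra.single m s}) :
    ∃ e : Localization T ≃+*
        AddMonoidAlgebra (Localization S) (AddLocalization (⊤ : AddSubmonoid M)),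
      ∀ (r : R) (s : S) (m n : M) (h : AddMonoidAlgebra.single n (s : R) ∈ T),
        e (Localization.mk (AddMonoidAlgebra.single m r) ⟨AddMonoidAlgebra.single n (s : R), h⟩) =
          AddMonoidAlgebra.single (AddLocalization.mk m ⟨n, AddSubmonoid.mem_top n⟩)
            (Localization.mk r s) := by
  classical
  have hmem : ∀ s ∈ S, ∀ m : M, AddMonoidAlgebra.single m s ∈ T := by
    intro s hs m
    rw [← SetLike.mem_coe, hT]
    exact ⟨s, hs, m, rfl⟩
  let F : AddMonoidAlgebra R M →+*
      AddMonoidAlgebra (Localization S) (AddLocalization (⊤ : AddSubmonoid M)) :=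
    (AddMonoidAlgebra.mapRingHom _ (algebraMap R (Localization S))).comp
      (AddMonoidAlgebra.mapDomainRingHom R (AddLocalization.addMonoidOf (⊤ : AddSubmonoid M)).toAddMonoidHom)
  have hF : ∀ (m : M) (r : R), F (AddMonoidAlgebra.single m r) =
      AddMonoidAlgebra.single (AddLocalization.mk m 0) (Localization.mk r 1) := by
    intro m r
    simp [F, Localization.mk_one_eq_algebraMap, AddLocalization.mk_zero_eq_addMonoidOf_mk]
    rfl
  have hmul : ∀ (r : R) (s : S) (m n : M),
      AddMonoidAlgebra.single (AddLocalization.mk m (⟨n, AddSubmonoid.mem_top n⟩ : (⊤ : AddSubmonoid M)))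
            (Localization.mk r s) * F (AddMonoidAlgebra.single n (s : R)) =
      F (AddMonoidAlgebra.single m r) := by
    intro r s m n
    rw [hF, hF, AddMonoidAlgebra.single_mul_single, AddLocalization.mk_add, Localization.mk_mul]
    congr 1
    · rw [AddLocalization.mk_eq_mk_iff, AddLocalization.r_iff_exists]
      refine ⟨0, ?_⟩
      simp [add_comm]
    · rw [Localization.mk_eq_mk_iff, Localization.r_iff_exists]
      refine ⟨1, ?_⟩
      simp [mul_comm]
  have hU : ∀ t : T, IsUnit (F t) := by
    rintro ⟨t, ht⟩
    have ht' := ht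
    rw [← SetLike.mem_coe, hT] at ht'
    obtain ⟨s, hs, m, rfl⟩ := ht'
    have h1 := hmul 1 ⟨s, hs⟩ 0 m
    have h2 : F (AddMonoidAlgebra.single 0 1) = 1 := by
      rw [← AddMonoidAlgebra.one_def, map_one]
    rw [h2] at h1
    exact IsUnit.of_mul_eq_one_right _ h1
  let E : Localization T →+* AddMonoidAlgebra (Localization S) (AddLocalization (⊤ : AddSubmonoid M)) :=
    IsLocalization.lift (M := T) hU
  have hE : ∀ x, E (algebraMap _ _ x) = F x := fun x => IsLocalization.lift_eq hU x
  have hEmk : ∀ (r : R) (s : S) (m n : M) (h : AddMonoidAlgebra.single n (s : R) ∈ T),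
        E (Localization.mk (AddMonoidAlgebra.single m r) ⟨AddMonoidAlgebra.single n (s : R), h⟩) =
          AddMonoidAlgebra.single (AddLocalization.mk m ⟨n, AddSubmonoid.mem_top n⟩)
            (Localization.mk r s) := by
    intro r s m n h
    rw [Localization.mk_eq_mk']
    refine (IsLocalization.lift_mk'_spec (M := T) (g := F) _ _ _ _).2 ?_
    rw [mul_comm]
    exact (hmul r s m n).symm
  -- the backward map
  have hA : ∀ s : S, IsUnit (((algebraMap (AddMonoidAlgebra R M) (Localization T)).comp
      AddMonoidAlgebra.singleZeroRingHom) (s : R)) := fun s =>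
    IsLocalization.map_units (Localization T) (⟨_, hmem s s.2 0⟩ : T)
  let A : Localization S →+* Localization T := IsLocalization.lift (M := S) hA
  let g0 : M →+ Additive (Localization T) :=
    MonoidHom.toAdditiveRight ((algebraMap (AddMonoidAlgebra R M) (Localization T)).toMonoidHom.comp
      (AddMonoidAlgebra.of R M))
  have hg0 : ∀ y : (⊤ : AddSubmonoid M), IsAddUnit (g0 y) := by
    intro y
    have : IsUnit (g0 y).toMul :=
      IsLocalization.map_units (Localization T) (⟨_, hmem 1 S.one_mem y⟩ : T)
    obtain ⟨b, hb⟩ := this.exists_right_inv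
    exact IsAddUnit.of_add_eq_zero (Additive.ofMul b) hb
  let g : AddLocalization (⊤ : AddSubmonoid M) →+ Additive (Localization T) :=
    (AddLocalization.addMonoidOf (⊤ : AddSubmonoid M)).lift hg0
  let B : AddMonoidAlgebra (Localization S) (AddLocalization (⊤ : AddSubmonoid M)) →+* Localization T :=
    AddMonoidAlgebra.liftNCRingHom A (AddMonoidHom.toMultiplicativeLeft g) (fun _ _ => Commute.all _ _)
  have hBF : B.comp F = algebraMap _ _ := by
    have hAr : ∀ r : R, A (Localization.mk r 1) =
        algebraMap (AddMonoidAlgebra R M) (Localization T) (AddMonoidAlgebra.single 0 r) := by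
      intro r
      rw [Localization.mk_one_eq_algebraMap]
      exact IsLocalization.lift_eq hA r
    have hgm : ∀ m : M, (g (AddLocalization.mk m 0)).toMul =
        algebraMap (AddMonoidAlgebra R M) (Localization T) (AddMonoidAlgebra.single m 1) := by
      intro m
      rw [AddLocalization.mk_zero_eq_addMonoidOf_mk]
      exact congrArg Additive.toMul
        ((AddLocalization.addMonoidOf (⊤ : AddSubmonoid M)).lift_eq hg0 m)
    have hB : ∀ (m : M) (r : R), B (F (AddMonoidAlgebra.single m r)) =
        algebraMap (AddMonoidAlgebra R M) (Localization T) (AddMonoidAlgebra.single m r) := by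
      intro m r
      rw [hF]
      have h1 : B (AddMonoidAlgebra.single (AddLocalization.mk m 0) (Localization.mk r 1)) =
          A (Localization.mk r 1) * (g (AddLocalization.mk m 0)).toMul :=
        AddMonoidAlgebra.liftNCRingHom_single _ _ _ _ _
      rw [h1, hAr, hgm, ← map_mul, AddMonoidAlgebra.single_mul_single, zero_add, mul_one]
    exact AddMonoidAlgebra.ringHom_ext (fun r => hB 0 r) (fun m => hB m 1)
  have hBE : B.comp E = RingHom.id _ := by
    refine IsLocalization.ringHom_ext T ?_
    refine RingHom.ext fun x => ?_
    simp only [RingHom.comp_apply, hE, RingHom.id_apply]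
    exact congrArg (fun f => f x) hBF
  have hinj : Function.Injective E := fun x y h => by
    simpa using (congrArg (fun f => f x) hBE).symm.trans ((congrArg B h).trans (congrArg (fun f => f y) hBE))
  have hsurj : Function.Surjective E := by
    intro y
    change y ∈ E.range
    induction y using AddMonoidAlgebra.induction_linear with
    | zero => exact zero_mem _
    | add f g hf hg => exact add_mem hf hg
    | single a b =>
      induction a using AddLocalization.induction_on with | H p
      induction b using Localization.induction_on with | H q
      exact ⟨_, hEmk q.1 q.2 p.1 p.2 (hmem _ q.2.2 _)⟩
  exact ⟨RingEquiv.ofBijective E ⟨hinj, hsurj⟩, hEmk⟩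
end

section
/- Let R be a commutative ring and M a commutative monoid with Grothendieck group G, and let T = { ε_m : m ∈ M } be the multiplicative set of monomials in the monoid ring R[M]. Then there is a canonical ring isomorphism T⁻¹(R[M]) ≅ R[G] sending each fraction ε_m/ε_n to ε_{[m,n]}. -/
/-- Let `R` be a commutative ring and `M` a commutative monoid with
Grothendieck group `G = AddLocalization (⊤ : AddSubmonoid M)`, and let `T = {ε_m : m ∈ M}`
be the multiplicative set of monomials of the monoid ring `R[M]`.  Then there is a canonical
ring isomorphism `T⁻¹(R[M]) ≃ R[G]` sending each fraction `ε_m/ε_n` to `ε_{[m,n]}`. -/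
theorem stmt_6 {R : Type*} [CommRing R] {M : Type*} [AddCommMonoid M]
    (T : Submonoid (AddMonoidAlgebra R M))
    (hT : (T : Set (AddMonoidAlgebra R M)) =
      {f | ∃ m : M, f = AddMonoidAlgebra.single m (1 : R)}) :
    ∃ e : Localization T ≃+* AddMonoidAlgebra R (AddLocalization (⊤ : AddSubmonoid M)),
      ∀ (m n : M) (h : AddMonoidAlgebra.single n (1 : R) ∈ T),
        e (Localization.mk (AddMonoidAlgebra.single m (1 : R))
            ⟨AddMonoidAlgebra.single n (1 : R), h⟩) =
          AddMonoidAlgebra.single (AddLocalization.mk m ⟨n, AddSubmonoid.mem_top n⟩) (1 : R) := by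
  classical
  have hmem : ∀ n : M, AddMonoidAlgebra.single n (1 : R) ∈ T := fun n => by
    have : AddMonoidAlgebra.single n (1 : R) ∈ (T : Set (AddMonoidAlgebra R M)) := by
      rw [hT]; exact ⟨n, rfl⟩
    exact this
  let G := AddLocalization (⊤ : AddSubmonoid M)
  let q : M →+ G := (AddLocalization.addMonoidOf (⊤ : AddSubmonoid M)).toAddMonoidHom
  have hq : ∀ m, q m = AddLocalization.mk m 0 := fun m =>
    (AddLocalization.mk_zero_eq_addMonoidOf_mk (S := (⊤ : AddSubmonoid M)) m).symm
  have hsub : ∀ m n : M, AddLocalization.mk m ⟨n, AddSubmonoid.mem_top n⟩ + q n = q m := by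
    intro m n
    rw [hq, hq, AddLocalization.mk_add, AddLocalization.mk_eq_mk_iff, AddLocalization.r_iff_exists]
    refine ⟨0, ?_⟩
    simp [add_comm]
  have hneg : ∀ n : M, ∃ g : G, g + q n = 0 := fun n =>
    ⟨AddLocalization.mk 0 ⟨n, AddSubmonoid.mem_top n⟩, by rw [hsub, map_zero]⟩
  let φ : AddMonoidAlgebra R M →+* AddMonoidAlgebra R G := AddMonoidAlgebra.mapDomainRingHom R q
  have hφ : ∀ m (r : R), φ (AddMonoidAlgebra.single m r) = AddMonoidAlgebra.single (q m) r := by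
    intro m r
    simp [φ]
  have hu : ∀ m, IsUnit (AddMonoidAlgebra.single (q m) (1 : R)) := by
    intro m
    obtain ⟨g, hg⟩ := hneg m
    refine IsUnit.of_mul_eq_one (AddMonoidAlgebra.single g 1) ?_
    rw [AddMonoidAlgebra.single_mul_single, add_comm, hg, one_mul, AddMonoidAlgebra.one_def]
  have hTu : ∀ y : T, IsUnit (φ y) := by
    rintro ⟨y, hy⟩
    have hy' : y ∈ (T : Set (AddMonoidAlgebra R M)) := hy
    rw [hT] at hy'
    obtain ⟨m, rfl⟩ := hy'
    simpa only [hφ] using hu m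
  let F : Localization T →+* AddMonoidAlgebra R G := IsLocalization.lift (M := T) hTu
  have hF : ∀ (m n : M) (h : AddMonoidAlgebra.single n (1 : R) ∈ T),
        F (Localization.mk (AddMonoidAlgebra.single m (1 : R))
            ⟨AddMonoidAlgebra.single n (1 : R), h⟩) =
          AddMonoidAlgebra.single (AddLocalization.mk m ⟨n, AddSubmonoid.mem_top n⟩) (1 : R) := by
    intro m n h
    rw [Localization.mk_eq_mk', IsLocalization.lift_mk'_spec, hφ, hφ,
      AddMonoidAlgebra.single_mul_single, add_comm, hsub, one_mul]
  let a : Multiplicative M →* Localization T :=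
    (algebraMap (AddMonoidAlgebra R M) (Localization T)).toMonoidHom.comp (AddMonoidAlgebra.of R M)
  have ha : ∀ m, a (.ofAdd m) = algebraMap _ _ (AddMonoidAlgebra.single m (1 : R)) := fun m => rfl
  have hau : ∀ m, IsUnit (a m) := fun m =>
    IsLocalization.map_units (Localization T) (⟨_, hmem m.toAdd⟩ : T)
  let gUnit : M →+ Additive (Localization T)ˣ := MonoidHom.toAdditiveRight (IsUnit.liftRight a hau)
  let b : G →+ Additive (Localization T)ˣ :=
    AddSubmonoid.LocalizationMap.lift (P := Additive (Localization T)ˣ)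
      (AddLocalization.addMonoidOf (⊤ : AddSubmonoid M))
      (g := gUnit) (fun _ => AddGroup.isAddUnit _)
  have hb : ∀ m, b (q m) = Additive.ofMul (IsUnit.liftRight a hau (.ofAdd m)) := fun m =>
    AddSubmonoid.LocalizationMap.lift_eq _ _ _
  let c : Multiplicative G →* Localization T :=
    (Units.coeHom (Localization T)).comp (AddMonoidHom.toMultiplicativeLeft b)
  have hc : ∀ m, c (.ofAdd (q m)) = algebraMap _ _ (AddMonoidAlgebra.single m (1 : R)) := by
    intro m
    change (((b (q m)).toMul : (Localization T)ˣ) : Localization T) = _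
    rw [hb]
    rfl
  let H : AddMonoidAlgebra R G →ₐ[R] Localization T := AddMonoidAlgebra.lift R (Localization T) G c
  have hH : ∀ m (r : R), H (AddMonoidAlgebra.single (q m) r) =
      algebraMap _ _ (AddMonoidAlgebra.single m r) := by
    intro m r
    have h1 : AddMonoidAlgebra.single m r = r • AddMonoidAlgebra.single m (1 : R) := by
      simp
    rw [AddMonoidAlgebra.lift_single, hc, h1]
    exact (map_smul (IsScalarTower.toAlgHom R (AddMonoidAlgebra R M) (Localization T)) r _).symm
  have hFa : ∀ x, F (algebraMap _ _ x) = φ x := fun x => IsLocalization.lift_eq hTu x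
  have h1 : (H : AddMonoidAlgebra R G →+* Localization T).comp F = RingHom.id _ := by
    refine IsLocalization.ringHom_ext T ?_
    refine AddMonoidAlgebra.ringHom_ext' ?_ ?_
    · ext r
      have := hH 0 r
      rw [map_zero] at this
      simpa [hFa, hφ] using this
    · ext m
      simp [hFa, hφ, hH]
  have hfix : ∀ m (r : R), F (H (AddMonoidAlgebra.single (q m) r)) =
      AddMonoidAlgebra.single (q m) r := fun m r => by rw [hH, hFa, hφ]
  have h2 : F.comp (H : AddMonoidAlgebra R G →+* Localization T) = RingHom.id _ := by
    refine AddMonoidAlgebra.ringHom_ext ?_ ?_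
    · intro r
      have := hfix 0 r
      rw [map_zero] at this
      exact this
    · intro g
      induction g using AddLocalization.induction_on with
      | H y =>
        obtain ⟨m, n, hn⟩ := y
        apply (hu n).mul_right_cancel
        have e : AddMonoidAlgebra.single (AddLocalization.mk m ⟨n, hn⟩ : G) (1 : R) *
            AddMonoidAlgebra.single (q n) 1 = AddMonoidAlgebra.single (q m) 1 := by
          rw [AddMonoidAlgebra.single_mul_single, hsub, one_mul]
        change F (H (AddMonoidAlgebra.single (AddLocalization.mk m ⟨n, hn⟩ : G) (1 : R))) *
            AddMonoidAlgebra.single (q n) 1 =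
          AddMonoidAlgebra.single (AddLocalization.mk m ⟨n, hn⟩ : G) (1 : R) *
            AddMonoidAlgebra.single (q n) 1
        rw [e]
        conv_lhs => rw [← hfix n 1]
        rw [← map_mul, ← map_mul, e, hfix]
  exact ⟨RingEquiv.ofRingHom F H h2 h1, hF⟩
end

section
/- A commutative monoid M is cancellative if and only if for every nonzero commutative ring R and every m ∈ M, the monomial ε_m is a non-zero-divisor of the monoid ring R[M]. -/
/-- The forward direction, for coefficient rings in any universe. -/
theorem single_mem_nonZeroDivisors_of_isCancelAdd {M : Type*} [AddCommMonoid M] [IsCancelAdd M]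
    (R : Type*) [CommRing R] (m : M) :
    AddMonoidAlgebra.single m (1 : R) ∈ nonZeroDivisors (AddMonoidAlgebra R M) := by
  rw [mem_nonZeroDivisors_iff_right]
  intro x hx
  ext a
  have h := AddMonoidAlgebra.coeff_mul_single_eq_coeff_mul (x := x) (r := (1 : R)) (m := m)
    (m₁ := a + m) a (fun m' _ => add_left_inj m)
  rw [hx] at h
  simpa using h.symm

/-- A commutative monoid `M` is cancellative if and only if for every
nonzero commutative ring `R` and every `m ∈ M`, the monomial `ε_m` is a non-zero-divisor
of the monoid ring `R[M]`. -/
theorem stmt_9 {M : Type*} [AddCommMonoid M] :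
    IsCancelAdd M ↔ ∀ (R : Type) [CommRing R] [Nontrivial R] (m : M),
      AddMonoidAlgebra.single m (1 : R) ∈ nonZeroDivisors (AddMonoidAlgebra R M) := by
  constructor
  · intro _ R _ _ m
    exact single_mem_nonZeroDivisors_of_isCancelAdd R m
  · intro h
    have key : ∀ a b c : M, a + c = b + c → a = b := by
      intro a b c habc
      have h1 := mem_nonZeroDivisors_iff_right.1 (h ℤ c)
        (AddMonoidAlgebra.single a 1 - AddMonoidAlgebra.single b 1)
        (by rw [sub_mul, AddMonoidAlgebra.single_mul_single,
              AddMonoidAlgebra.single_mul_single, habc, sub_self])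
      exact (AddMonoidAlgebra.single_left_inj one_ne_zero).1 (sub_eq_zero.1 h1)
    haveI : IsRightCancelAdd M := ⟨fun c a b hab => key a b c hab⟩
    exact AddCommMagma.IsRightCancelAdd.toIsCancelAdd M
end

section
/- A cancellative commutative monoid M admits a total order making it a totally ordered monoid if and only if the Grothendieck group of M is torsion-free. -/
/-- A cancellative commutative monoid `M` admits a total order making it a
totally ordered monoid (`a < b → a + c ≤ b + c`) if and only if its Grothendieck group
`G = AddLocalization (⊤ : AddSubmonoid M)` is torsion-free
(`n • x = 0` with `n ≥ 1` implies `x = 0`). -/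
theorem stmt_11 {M : Type*} [AddCommMonoid M] [IsCancelAdd M] :
    (∃ _ : LinearOrder M, ∀ a b c : M, a < b → a + c ≤ b + c) ↔
      ∀ (x : AddLocalization (⊤ : AddSubmonoid M)) (n : ℕ), 0 < n → n • x = 0 → x = 0 := by
  constructor
  · rintro ⟨_, h⟩ x n hn hx
    have hlt : ∀ a b c : M, a < b → a + c < b + c := fun a b c hab =>
      lt_of_le_of_ne (h a b c hab) fun e => hab.ne (add_right_cancel e)
    have hs : ∀ (a b : M), a < b → ∀ k : ℕ, (k + 1) • a < (k + 1) • b := by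
      intro a b hab k
      induction k with
      | zero => simpa using hab
      | succ k ih =>
        rw [succ_nsmul a, succ_nsmul b]
        refine (hlt _ _ a ih).trans ?_
        rw [add_comm _ a, add_comm _ b]
        exact hlt _ _ _ hab
    obtain ⟨k, rfl⟩ : ∃ k, n = k + 1 := ⟨n - 1, by omega⟩
    induction x using AddLocalization.ind with
    | _ y =>
      obtain ⟨a, b⟩ := y
      rw [AddLocalization.mk_nsmul, ← AddLocalization.mk_zero, AddLocalization.mk_eq_mk_iff'] at hx
      rw [← AddLocalization.mk_zero, AddLocalization.mk_eq_mk_iff']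
      simp only [AddSubmonoid.coe_zero, zero_add, add_zero, AddSubmonoidClass.coe_nsmul] at hx ⊢
      rcases lt_trichotomy a (b : M) with hab | hab | hab
      · exact absurd hx (hs _ _ hab k).ne
      · exact hab
      · exact absurd hx (hs _ _ hab k).ne'
  · classical
    intro h
    let G := Algebra.GrothendieckAddGroup M
    haveI : IsAddTorsionFree G := by
      refine ⟨fun n hn a b hab => ?_⟩
      have h2 : n • (a - b) = 0 := by
        rw [nsmul_sub]; exact sub_eq_zero.2 hab
      exact sub_eq_zero.1 (h (a - b) n (Nat.pos_of_ne_zero hn) h2)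
    let B := Module.Basis.ofVectorSpace ℚ (DivisibleHull G)
    letI : LinearOrder (Module.Basis.ofVectorSpaceIndex ℚ (DivisibleHull G)) :=
      linearOrderOfSTO WellOrderingRel
    let f : M → Lex (Module.Basis.ofVectorSpaceIndex ℚ (DivisibleHull G) →₀ ℚ) := fun m =>
      toLex (B.repr (DivisibleHull.coe (Algebra.GrothendieckAddGroup.of m : G)))
    have hf : Function.Injective f := fun a b hab =>
      Algebra.GrothendieckAddGroup.of_injective
        (DivisibleHull.coe_injective (B.repr.injective (toLex.injective hab)))
    have hadd : ∀ a b, f (a + b) = f a + f b := by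
      intro a b
      simp only [f, map_add, DivisibleHull.coe_add]
      rfl
    refine ⟨LinearOrder.lift' f hf, fun a b c hab => ?_⟩
    have hab' : f a < f b := hab
    change f (a + c) ≤ f (b + c)
    rw [hadd, hadd]
    exact add_le_add_left hab'.le (f c)
end

section
/- (Levi's theorem) Every torsion-free abelian group admits a total order making it a totally ordered group, i.e., a total order < such that a < b implies a+c < b+c for all c. -/
/-- A maximal pointed cone. -/
theorem exists_maximal_pointed (G : Type*) [AddCommGroup G] :
    ∃ P : AddSubmonoid G, Maximal (fun P : AddSubmonoid G => ∀ x, x ∈ P → -x ∈ P → x = 0) P := by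
  refine zorn_le₀ {P : AddSubmonoid G | ∀ x, x ∈ P → -x ∈ P → x = 0} ?_
  intro c hc hchain
  rcases c.eq_empty_or_nonempty with rfl | hne
  · refine ⟨⊥, ?_, by simp⟩
    intro x hx _
    simpa using hx
  · refine ⟨sSup c, ?_, fun z hz => le_sSup hz⟩
    intro x hx hx'
    rw [AddSubmonoid.mem_sSup_of_directedOn hne hchain.directedOn] at hx hx'
    obtain ⟨s, hs, hxs⟩ := hx
    obtain ⟨t, ht, hxt⟩ := hx'
    rcases hchain.total hs ht with hst | hst
    · exact hc ht x (hst hxs) hxt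
    · exact hc hs x hxs (hst hxt)

theorem pointed_aux {G : Type*} [AddCommGroup G] (P : AddSubmonoid G)
    (hP : Maximal (fun P : AddSubmonoid G => ∀ x, x ∈ P → -x ∈ P → x = 0) P)
    (x : G) (hx : x ∉ P) : ∃ k : ℕ, 0 < k ∧ -(k • x) ∈ P := by
  by_contra! hk
  apply hx
  have hle : P ⊔ AddSubmonoid.multiples x ≤ P := by
    refine hP.2 ?_ le_sup_left
    intro y hy hy'
    rw [AddSubmonoid.mem_sup] at hy hy'
    obtain ⟨p, hp, _, ⟨n, rfl⟩, h1⟩ := hy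
    obtain ⟨q, hq, _, ⟨m, rfl⟩, h2⟩ := hy'
    simp only at h1 h2
    have h3 : -((n + m) • x) = p + q := by
      have : (p + n • x) + (q + m • x) = 0 := by rw [h1, h2]; simp
      rw [add_smul, neg_eq_iff_add_eq_zero, ← this]; abel
    have h4 : n + m = 0 := by
      by_contra h0
      exact hk (n + m) (Nat.pos_of_ne_zero h0) (h3 ▸ P.add_mem hp hq)
    obtain ⟨rfl, rfl⟩ : n = 0 ∧ m = 0 := by omega
    simp only [zero_smul, add_zero] at h1 h2
    subst h1
    exact hP.1 p hp (h2 ▸ hq)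
  exact hle (AddSubmonoid.mem_sup_right (AddSubmonoid.mem_multiples x))

/-- **Levi's theorem.** Every torsion-free abelian group admits a total order
making it a totally ordered group: a total order `<` such that `a < b → a + c < b + c`. -/
theorem stmt_12 {G : Type*} [AddCommGroup G]
    (h : ∀ (x : G) (n : ℕ), 0 < n → n • x = 0 → x = 0) :
    ∃ _ : LinearOrder G, ∀ a b c : G, a < b → a + c < b + c := by
  classical
  obtain ⟨P, hP⟩ := exists_maximal_pointed G
  have htot : ∀ x, x ∈ P ∨ -x ∈ P := by
    intro x
    by_contra! hx
    obtain ⟨k, hk, hkP⟩ := pointed_aux P hP x hx.1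
    obtain ⟨l, hl, hlP⟩ := pointed_aux P hP (-x) hx.2
    have h1 : (k * l) • x ∈ P := by
      have := P.nsmul_mem hlP k
      simpa [mul_smul] using this
    have h2 : -((k * l) • x) ∈ P := by
      have := P.nsmul_mem hkP l
      rw [mul_comm]
      simpa [mul_smul] using this
    have h0 := h x _ (Nat.mul_pos hk hl) (hP.1 _ h1 h2)
    exact hx.1 (h0 ▸ P.zero_mem)
  let L : LinearOrder G :=
    { le := fun a b => b - a ∈ P
      le_refl := fun a => by simp
      le_trans := fun a b c hab hbc => by
        have := P.add_mem hbc hab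
        simpa using this
      le_antisymm := fun a b hab hba => by
        have := hP.1 (b - a) hab (by simpa using hba)
        exact (sub_eq_zero.mp this).symm
      le_total := fun a b => by
        simpa using htot (b - a)
      toDecidableLE := Classical.decRel _ }
  refine ⟨L, fun a b c hab => ?_⟩
  rw [lt_iff_le_not_ge] at hab ⊢
  change b - a ∈ P ∧ ¬ (a - b ∈ P) at hab
  change b + c - (a + c) ∈ P ∧ ¬ (a + c - (b + c) ∈ P)
  simpa using hab
end

section
/- Let S be a saturated multiplicative subset of a commutative ring R. Then the canonical map from the Grothendieck group G = {[s,t] : s,t ∈ S} of the multiplicative monoid S to (S⁻¹R)*, given by [s,t] ↦ s/t, is a group isomorphism. -/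
/-- Let `S` be a saturated multiplicative subset of a commutative ring `R`.
Then the canonical map from the Grothendieck group `G = Localization (⊤ : Submonoid S)` of
the multiplicative monoid `S` to `(S⁻¹R)ˣ`, `[s, t] ↦ s/t`, is a group isomorphism. -/
theorem stmt_15 {R : Type*} [CommRing R] (S : Submonoid R)
    (hsat : ∀ a : R, (∃ b : R, a * b ∈ S) → a ∈ S) :
    ∃ e : Localization (⊤ : Submonoid S) ≃* (Localization S)ˣ,
      ∀ s t : S, (e (Localization.mk s ⟨t, Submonoid.mem_top t⟩) : Localization S) =
        Localization.mk (s : R) t := by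
  classical
  have hone : ∀ s : S, Localization.mk (s : R) s = 1 := fun s => Localization.mk_self s
  let f : S →* (Localization S)ˣ :=
    { toFun := fun s => ⟨Localization.mk (s : R) 1, Localization.mk 1 s,
        by rw [Localization.mk_mul, mul_one, one_mul, hone],
        by rw [Localization.mk_mul, mul_one, one_mul, hone]⟩
      map_one' := Units.ext (Localization.mk_one)
      map_mul' := fun a b => Units.ext (by
        simp [Localization.mk_mul]) }
  let g : Localization (⊤ : Submonoid S) →* (Localization S)ˣ :=
    (Localization.monoidOf (⊤ : Submonoid S)).lift (g := f) (fun y => Group.isUnit _)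
  have hg : ∀ s t : S, (g (Localization.mk s ⟨t, Submonoid.mem_top t⟩) : Localization S) =
      Localization.mk (s : R) t := by
    intro s t
    have h : g (Localization.mk s ⟨t, Submonoid.mem_top t⟩) * f t = f s := by
      have h1 : ∀ x : S, g (Localization.mk x 1) = f x := fun x =>
        (Localization.monoidOf (⊤ : Submonoid S)).lift_eq _ x
      rw [← h1, ← h1, ← map_mul, Localization.mk_mul]
      congr 1
      rw [Localization.mk_eq_mk_iff, Localization.r_iff_exists]
      exact ⟨1, by simp [mul_comm]⟩
    rw [eq_mul_inv_of_mul_eq h]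
    change Localization.mk (s : R) 1 * Localization.mk 1 t = _
    rw [Localization.mk_mul, mul_one, one_mul]
  have hinj : Function.Injective g := by
    intro x y
    induction x using Localization.induction_on with | _ x
    induction y using Localization.induction_on with | _ y
    obtain ⟨s, t, ht⟩ := x
    obtain ⟨s', t', ht'⟩ := y
    intro h
    have h2 := congrArg Units.val h
    have h3 : Localization.mk (s : R) t = Localization.mk (s' : R) t' :=
      (hg s t).symm.trans (h2.trans (hg s' t'))
    rw [Localization.mk_eq_mk_iff, Localization.r_iff_exists] at h3 ⊢
    obtain ⟨c, hc⟩ := h3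
    exact ⟨⟨c, Submonoid.mem_top c⟩, Subtype.ext hc⟩
  have hsurj : Function.Surjective g := by
    intro u
    obtain ⟨⟨a, t⟩, ha⟩ : ∃ p : R × S, Localization.mk p.1 p.2 = (u : Localization S) := by
      induction h : (u : Localization S) using Localization.induction_on with | _ p
      exact ⟨p, rfl⟩
    obtain ⟨⟨b, t'⟩, hb⟩ : ∃ p : R × S, Localization.mk p.1 p.2 = ((u⁻¹ : (Localization S)ˣ) : Localization S) := by
      induction h : ((u⁻¹ : (Localization S)ˣ) : Localization S) using Localization.induction_on with | _ p
      exact ⟨p, rfl⟩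
    have h := u.mul_inv
    rw [← ha, ← hb, Localization.mk_mul, ← Localization.mk_one, Localization.mk_eq_mk_iff,
      Localization.r_iff_exists] at h
    obtain ⟨c, hc⟩ := h
    have haS : a ∈ S := by
      refine hsat a ⟨b * c, ?_⟩
      have : a * (b * c) = ((c * (t * t') : S) : R) := by
        simp at hc
        push_cast
        rw [← hc]; ring
      rw [this]
      exact Subtype.property _
    exact ⟨Localization.mk ⟨a, haS⟩ ⟨t, Submonoid.mem_top t⟩, Units.ext ((hg _ _).trans ha)⟩
  exact ⟨MulEquiv.ofBijective g ⟨hinj, hsurj⟩, hg⟩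
end

section
/- Let S be a multiplicative subset of a commutative ring R with saturation S̄ = { a ∈ R : ∃ b ∈ R, ab ∈ S }. Then the Grothendieck group of the multiplicative monoid S̄ is canonically isomorphic to the group of units (S⁻¹R)* of S⁻¹R. -/
/-- Let `S` be a multiplicative subset of a commutative ring `R` and let
`T = S̄ = {a ∈ R : ∃ b, a·b ∈ S}` be its saturation.  Then the Grothendieck group of the
multiplicative monoid `S̄` is canonically isomorphic to the group of units of `S⁻¹R`; the
canonical isomorphism sends `[s, t]` to the unit `(s/1)·(t/1)⁻¹`, i.e. it is the unique map
`e` with `e [s, t] · (t/1) = s/1` for all `s, t ∈ S̄`. -/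
theorem stmt_18 {R : Type*} [CommRing R] (S T : Submonoid R)
    (hT : (T : Set R) = {a : R | ∃ b : R, a * b ∈ S}) :
    ∃ e : Localization (⊤ : Submonoid T) ≃* (Localization S)ˣ,
      ∀ s t : T,
        (e (Localization.mk s ⟨t, Submonoid.mem_top t⟩) : Localization S) *
            Localization.mk (t : R) 1 = Localization.mk (s : R) 1 := by
  have hmem : ∀ a : R, a ∈ T ↔ ∃ b : R, a * b ∈ S := fun a => by
    rw [← SetLike.mem_coe, hT]; rfl
  have hST : ∀ c ∈ S, c ∈ T := fun c hc => (hmem c).2 ⟨1, by simpa using hc⟩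
  have hu : ∀ t : T, IsUnit
      (((algebraMap R (Localization S) : R →* Localization S).comp T.subtype) t) := by
    rintro ⟨t, ht⟩
    obtain ⟨b, hb⟩ := (hmem t).1 ht
    have h := IsLocalization.map_units (Localization S) (⟨t * b, hb⟩ : S)
    simp only [map_mul] at h
    exact isUnit_of_mul_isUnit_left h
  let f : T →* (Localization S)ˣ := IsUnit.liftRight _ hu
  have hf : ∀ t : T, ((f t : (Localization S)ˣ) : Localization S)
      = algebraMap R (Localization S) t := fun t => IsUnit.coe_liftRight _ hu t
  let F : Localization (⊤ : Submonoid T) →* (Localization S)ˣ :=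
    (Localization.monoidOf (⊤ : Submonoid T)).lift (g := f) (fun y => Group.isUnit _)
  have hF : ∀ s t : T, F (Localization.mk s ⟨t, Submonoid.mem_top t⟩) * f t = f s := by
    intro s t
    have h1 : ∀ x : T, F (Localization.mk x 1) = f x := fun x => by
      rw [Localization.mk_one_eq_monoidOf_mk]
      exact (Localization.monoidOf (⊤ : Submonoid T)).lift_eq _ x
    rw [← h1 t, ← h1 s, ← map_mul, Localization.mk_mul]
    congr 1
    rw [Localization.mk_eq_mk_iff, Localization.r_iff_exists]
    exact ⟨1, by simp [mul_comm]⟩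
  have hF' : ∀ s t : T, (F (Localization.mk s ⟨t, Submonoid.mem_top t⟩) : Localization S) *
      algebraMap R (Localization S) t = algebraMap R (Localization S) s := by
    intro s t
    rw [← hf, ← hf, ← hF s t, Units.val_mul]
  have hinj : Function.Injective F := by
    intro x y
    induction x using Localization.induction_on with | _ x
    induction y using Localization.induction_on with | _ y
    obtain ⟨s, t, -⟩ := x
    obtain ⟨s', t', -⟩ := y
    intro h
    have e1 := hF' s t
    have e2 := hF' s' t'
    dsimp only at h
    rw [h] at e1
    have e3 : algebraMap R (Localization S) (t' * s) = algebraMap R (Localization S) (t * s') := by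
      rw [map_mul, map_mul, ← e1, ← e2]; ring
    obtain ⟨c, hc⟩ := (IsLocalization.eq_iff_exists S (Localization S)).1 e3
    rw [Localization.mk_eq_mk_iff, Localization.r_iff_exists]
    exact ⟨⟨⟨c, hST c c.2⟩, Submonoid.mem_top _⟩, Subtype.ext hc⟩
  have hsurj : Function.Surjective F := by
    intro u
    obtain ⟨a, c, hac⟩ := IsLocalization.exists_mk'_eq S (u : Localization S)
    obtain ⟨b, d, hbd⟩ := IsLocalization.exists_mk'_eq S ((u⁻¹ : (Localization S)ˣ) : Localization S)
    have ha := IsLocalization.mk'_spec (Localization S) a c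
    have hb := IsLocalization.mk'_spec (Localization S) b d
    rw [hac] at ha
    rw [hbd] at hb
    have e3 : algebraMap R (Localization S) (a * b) = algebraMap R (Localization S) (c * d) := by
      rw [map_mul, map_mul, ← ha, ← hb]
      linear_combination (algebraMap R (Localization S) c * algebraMap R (Localization S) d)
        * u.mul_inv
    obtain ⟨k, hk⟩ := (IsLocalization.eq_iff_exists S (Localization S)).1 e3
    have haT : a ∈ T := (hmem a).2 ⟨b * k, by
      have : a * (b * k) = k * (c * d) := by rw [← hk]; ring
      rw [this]
      exact S.mul_mem k.2 (S.mul_mem c.2 d.2)⟩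
    refine ⟨Localization.mk ⟨a, haT⟩ ⟨⟨c, hST c c.2⟩, Submonoid.mem_top _⟩, ?_⟩
    apply Units.ext
    apply (IsLocalization.map_units (Localization S) c).mul_right_cancel
    rw [ha]
    exact hF' ⟨a, haT⟩ ⟨c, hST c c.2⟩
  refine ⟨MulEquiv.ofBijective F ⟨hinj, hsurj⟩, fun s t => ?_⟩
  have := hF' s t
  rw [← Localization.mk_one_eq_algebraMap, ← Localization.mk_one_eq_algebraMap] at this
  exact this
end

section
/- Let I be an ideal of a commutative ring R, let T = R ∖ ⋃ 𝔪 be the complement of the union of all maximal ideals 𝔪 of R containing I, and let S = 1 + I. Then T is the saturation of S, and the Grothendieck group of the multiplicative monoid T is canonically isomorphic to the group of units (S⁻¹R)* of the localization S⁻¹R. -/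
/-- Let `I` be an ideal of a commutative ring `R`, let
`T = R ∖ ⋃ {𝔪 maximal : I ⊆ 𝔪}` and `S = 1 + I`.  Then `T` is the saturation of `S`, and
the Grothendieck group of the multiplicative monoid `T` is canonically isomorphic to the
group of units of `S⁻¹R`; the canonical isomorphism sends `[s, t]` to the unit
`(s/1)·(t/1)⁻¹`, i.e. it is the unique map `e` with `e [s, t] · (t/1) = s/1`. -/
theorem stmt_19 {R : Type*} [CommRing R] (I : Ideal R) (S T : Submonoid R)
    (hS : (S : Set R) = {r : R | ∃ a ∈ I, r = 1 + a})
    (hT : (T : Set R) = {r : R | ∀ m : Ideal R, m.IsMaximal → I ≤ m → r ∉ m}) :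
    (T : Set R) = {a : R | ∃ b : R, a * b ∈ S} ∧
    ∃ e : Localization (⊤ : Submonoid T) ≃* (Localization S)ˣ,
      ∀ s t : T,
        (e (Localization.mk s ⟨t, Submonoid.mem_top t⟩) : Localization S) *
            Localization.mk (t : R) 1 = Localization.mk (s : R) 1 := by
  have memS : ∀ x, x ∈ S ↔ ∃ a ∈ I, x = 1 + a := fun x => by
    rw [← SetLike.mem_coe, hS]; rfl
  have memT : ∀ x, x ∈ T ↔ ∀ m : Ideal R, m.IsMaximal → I ≤ m → x ∉ m := fun x => by
    rw [← SetLike.mem_coe, hT]; rfl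
  have sat : ∀ x, x ∈ T ↔ ∃ b : R, x * b ∈ S := by
    intro x
    constructor
    · intro hx
      have htop : I ⊔ Ideal.span {x} = ⊤ := by
        by_contra hne
        obtain ⟨m, hm, hle⟩ := Ideal.exists_le_maximal _ hne
        exact (memT x).1 hx m hm (le_sup_left.trans hle)
          (hle (le_sup_right (a := I) (Ideal.mem_span_singleton_self x)))
      have h1 : (1 : R) ∈ I ⊔ Ideal.span {x} := by rw [htop]; trivial
      obtain ⟨a, ha, y, hy, hay⟩ := Submodule.mem_sup.1 h1
      obtain ⟨b, rfl⟩ := Ideal.mem_span_singleton'.1 hy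
      exact ⟨b, (memS _).2 ⟨-a, I.neg_mem ha, by linear_combination hay⟩⟩
    · rintro ⟨b, hb⟩
      obtain ⟨a, ha, hab⟩ := (memS _).1 hb
      refine (memT x).2 fun m hm hI hx => hm.ne_top ((Ideal.eq_top_iff_one m).2 ?_)
      have : (1 : R) = x * b - a := by rw [hab]; ring
      rw [this]
      exact m.sub_mem (m.mul_mem_right _ hx) (hI ha)
  have hST : ∀ x ∈ S, x ∈ T := fun x hx => (sat x).2 ⟨1, by simpa using hx⟩
  have unit_iff : ∀ x : R, IsUnit (algebraMap R (Localization S) x) ↔ x ∈ T := by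
    intro x
    rw [sat]
    constructor
    · intro h
      obtain ⟨y, hy⟩ := h.exists_right_inv
      obtain ⟨⟨r, s⟩, hr⟩ := IsLocalization.surj S y
      have h2 : algebraMap R (Localization S) (x * r) = algebraMap R (Localization S) s := by
        rw [map_mul, ← hr, ← mul_assoc, hy, one_mul]
      obtain ⟨c, hc⟩ := (IsLocalization.eq_iff_exists S (Localization S)).1 h2
      refine ⟨r * c, ?_⟩
      have : x * (r * c) = c * s := by rw [← hc]; ring
      rw [this]
      exact S.mul_mem c.2 s.2
    · rintro ⟨b, hb⟩
      have := IsLocalization.map_units (Localization S) (⟨x * b, hb⟩ : S)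
      simp only [map_mul] at this
      exact isUnit_of_mul_isUnit_left this
  refine ⟨Set.ext sat, ?_⟩
  let g : T →* Localization S := ((algebraMap R (Localization S)) : R →* Localization S).comp T.subtype
  let f : T →* (Localization S)ˣ := IsUnit.liftRight g fun t => (unit_iff t).2 t.2
  have hf : ∀ t : T, ((f t : (Localization S)ˣ) : Localization S) = algebraMap R _ (t : R) :=
    fun t => rfl
  let L := Localization.monoidOf (⊤ : Submonoid T)
  have hu : ∀ y : (⊤ : Submonoid T), IsUnit (f y) := fun y => Group.isUnit _
  have hbij : Function.Bijective (L.lift hu) := by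
    constructor
    · rw [L.lift_injective_iff hu]
      intro x y
      constructor
      · intro h
        obtain ⟨c, hc⟩ := L.eq_iff_exists.1 h
        have := congrArg f hc
        simpa using this
      · intro h
        have h2 := congrArg (Units.val) h
        rw [hf, hf] at h2
        obtain ⟨c, hc⟩ := (IsLocalization.eq_iff_exists S (Localization S)).1 h2
        exact L.eq_iff_exists.2 ⟨⟨⟨c, hST _ c.2⟩, trivial⟩, Subtype.ext hc⟩
    · rw [L.lift_surjective_iff hu]
      intro v
      obtain ⟨⟨r, s⟩, hr⟩ := IsLocalization.surj S (v : Localization S)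
      have hrT : r ∈ T := by
        rw [← unit_iff, ← hr]
        exact v.isUnit.mul (IsLocalization.map_units _ s)
      exact ⟨⟨⟨r, hrT⟩, ⟨⟨s, hST _ s.2⟩, trivial⟩⟩, Units.ext hr⟩
  refine ⟨MulEquiv.ofBijective (L.lift hu) hbij, fun s t => ?_⟩
  have key : L.lift hu (Localization.mk s ⟨t, Submonoid.mem_top t⟩) * f t = f s := by
    rw [Localization.mk_eq_monoidOf_mk'_apply, mul_comm]
    exact ((L.lift_mk'_spec hu s _ ⟨t, Submonoid.mem_top t⟩).1 rfl).symm
  have h2 := congrArg Units.val key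
  rw [Units.val_mul, hf, hf] at h2
  rw [Localization.mk_one_eq_algebraMap, Localization.mk_one_eq_algebraMap]
  exact h2
end
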